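/- arXiv:1404.4378 — 2 statements merged into one kernel-verified Lean document; each statement's English description precedes it below -/
import Mathlib

section
/- Any closed C¹, piecewise C² arc-length parametrized plane curve σ : [0,s] → ℝ² with σ(0) = σ(s), σ'(0) = σ'(s), and curvature bound ‖σ''(t)‖ ≤ 1/r wherever defined, has length s ≥ 2πr; equality holds if σ is a circle of radius r. -/
open Set Real

noncomputable section

abbrev Plane := EuclideanSpace ℝ (Fin 2)

def IsKConstrained (κ s : ℝ) (σ σ' σ'' : ℝ → Plane) : Prop :=
  0 ≤ s ∧
  (∀ t ∈ Icc (0:ℝ) s, HasDerivAt σ (σ' t) t) ∧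
  ContinuousOn σ' (Icc 0 s) ∧
  (∀ t ∈ Icc (0:ℝ) s, ‖σ' t‖ = 1) ∧
  ∃ F : Finset ℝ, ∀ t ∈ Icc (0:ℝ) s, t ∉ F →
    HasDerivAt σ' (σ'' t) t ∧ ‖σ'' t‖ ≤ κ

/-- Mean value inequality for a curve that is differentiable off a finite set. -/
theorem norm_image_sub_le_of_hasDerivAt_off_finset {E : Type*} [NormedAddCommGroup E]
    [InnerProductSpace ℝ E] {f f' : ℝ → E} {C : ℝ} (F : Finset ℝ) :
    ∀ {a b : ℝ}, a ≤ b → ContinuousOn f (Icc a b) →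
      (∀ t ∈ Ioo a b, t ∉ F → HasDerivAt f (f' t) t ∧ ‖f' t‖ ≤ C) →
      ‖f b - f a‖ ≤ C * (b - a) := by
  induction F using Finset.induction_on with
  | empty =>
    intro a b hab hf hd
    rcases hab.eq_or_lt with rfl | hlt
    · simp
    have hd' : ∀ t ∈ Ioo a b, HasDerivAt f (f' t) t ∧ ‖f' t‖ ≤ C :=
      fun t ht => hd t ht (by simp)
    set v := f b - f a with hv
    obtain ⟨c, hc, hslope⟩ := exists_hasDerivAt_eq_slope (fun t => inner ℝ v (f t))
      (fun t => inner ℝ v (f' t)) hlt (continuousOn_const.inner hf)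
      (fun t ht => by
        simpa using (hasDerivAt_const t v).inner ℝ (hd' t ht).1)
    have hpos : 0 < b - a := sub_pos.2 hlt
    rw [eq_div_iff hpos.ne', ← inner_sub_right, ← hv, real_inner_self_eq_norm_sq] at hslope
    have hcs : inner ℝ v (f' c) ≤ ‖v‖ * C :=
      (real_inner_le_norm _ _).trans
        (mul_le_mul_of_nonneg_left (hd' c hc).2 (norm_nonneg _))
    have hC : 0 ≤ C := (norm_nonneg _).trans (hd' c hc).2
    rcases (norm_nonneg v).eq_or_lt with h0 | h0
    · rw [← h0]; positivity
    · refine le_of_mul_le_mul_left ?_ h0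
      nlinarith [mul_le_mul_of_nonneg_right hcs hpos.le]
  | insert x F _ ih =>
    intro a b hab hf hd
    by_cases hx : x ∈ Ioo a b
    · have h1 := ih hx.1.le (hf.mono (Icc_subset_Icc_right hx.2.le)) fun t ht htF =>
        hd t ⟨ht.1, ht.2.trans hx.2⟩ (by simp [ht.2.ne, htF])
      have h2 := ih hx.2.le (hf.mono (Icc_subset_Icc_left hx.1.le)) fun t ht htF =>
        hd t ⟨hx.1.trans ht.1, ht.2⟩ (by simp [ht.1.ne', htF])
      have h3 := norm_sub_le_norm_sub_add_norm_sub (f b) (f x) (f a)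
      linarith
    · refine ih hab hf fun t ht htF => hd t ht ?_
      have : t ≠ x := fun h => hx (h ▸ ht)
      simp [this, htF]

theorem angle_eq_two_mul_arcsin_of_norm_eq_one {E : Type*} [NormedAddCommGroup E]
    [InnerProductSpace ℝ E] {x y : E} (hx : ‖x‖ = 1) (hy : ‖y‖ = 1) :
    InnerProductGeometry.angle x y = 2 * arcsin (‖x - y‖ / 2) := by
  have hle : ‖x - y‖ ≤ 2 := by
    have := norm_sub_le x y
    linarith
  have hnn := norm_nonneg (x - y)
  have h0 : 0 ≤ arcsin (‖x - y‖ / 2) := arcsin_nonneg.2 (by positivity)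
  have hcos : inner ℝ x y = cos (2 * arcsin (‖x - y‖ / 2)) := by
    have h := norm_sub_sq_real x y
    rw [cos_two_mul, cos_sq', sin_arcsin (by linarith) (by linarith)]
    rw [hx, hy] at h
    linarith
  rw [InnerProductGeometry.angle, hx, hy, hcos, mul_one, div_one, arccos_cos (by positivity)]
  linarith [arcsin_le_pi_div_two (‖x - y‖ / 2)]

/-- On the unit sphere, the angular distance travelled by a Lipschitz curve is controlled by
its Lipschitz constant. -/
theorem angle_le_of_norm_sub_le {E : Type*} [NormedAddCommGroup E] [InnerProductSpace ℝ E]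
    {f : ℝ → E} {C a b : ℝ} (hab : a ≤ b) (hunit : ∀ t ∈ Icc a b, ‖f t‖ = 1)
    (hlip : ∀ x ∈ Icc a b, ∀ y ∈ Icc a b, x ≤ y → ‖f y - f x‖ ≤ C * (y - x)) :
    InnerProductGeometry.angle (f a) (f b) ≤ C * (b - a) := by
  have hstep : ∀ n : ℕ, ∀ h : ℝ, 0 ≤ h → a + n * h ≤ b →
      InnerProductGeometry.angle (f a) (f (a + n * h)) ≤ n * (2 * arcsin (C * h / 2)) := by
    intro n h hh
    induction n with
    | zero =>
      intro _
      have : f a ≠ 0 := fun h0 => by simpa [h0] using hunit a ⟨le_rfl, hab⟩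
      simp [InnerProductGeometry.angle_self this]
    | succ n ih =>
      intro hn
      push_cast at hn ⊢
      have hnh : 0 ≤ n * h := by positivity
      have hm : a + n * h ∈ Icc a b := ⟨by linarith, by linarith⟩
      have hm' : a + (n + 1) * h ∈ Icc a b := ⟨by linarith, hn⟩
      have h1 := ih hm.2
      have h2 : InnerProductGeometry.angle (f (a + n * h)) (f (a + (n + 1) * h)) ≤
          2 * arcsin (C * h / 2) := by
        rw [angle_eq_two_mul_arcsin_of_norm_eq_one (hunit _ hm) (hunit _ hm'), norm_sub_rev]
        have h3 := hlip _ hm _ hm' (by linarith)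
        have h4 : C * (a + (n + 1) * h - (a + n * h)) = C * h := by ring
        rw [h4] at h3
        gcongr
      have h5 := InnerProductGeometry.angle_le_angle_add_angle (f a) (f (a + n * h))
        (f (a + (n + 1) * h))
      linarith
  have hderiv : HasDerivAt (fun y => 2 * arcsin (C * (b - a) * y / 2)) (C * (b - a)) 0 := by
    have h1 : HasDerivAt (fun y : ℝ => C * (b - a) * y / 2) (C * (b - a) / 2) 0 := by
      simpa using ((hasDerivAt_id (0 : ℝ)).const_mul (C * (b - a))).div_const 2
    have h2 : HasDerivAt arcsin 1 (C * (b - a) * 0 / 2) := by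
      simpa using hasDerivAt_arcsin (x := 0) (by norm_num) (by norm_num)
    have h3 := (h2.comp (0 : ℝ) h1).const_mul 2
    exact h3.congr_deriv (by ring)
  have hseq : Filter.Tendsto (fun n : ℕ => 1 / ((n : ℝ) + 1)) Filter.atTop (nhdsWithin 0 {0}ᶜ) :=
    tendsto_nhdsWithin_iff.2 ⟨tendsto_one_div_add_atTop_nhds_zero_nat,
      Filter.Eventually.of_forall fun n => by
        simp only [mem_compl_iff, mem_singleton_iff]; positivity⟩
  refine ge_of_tendsto' (hderiv.tendsto_slope_zero.comp hseq) fun n => ?_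
  have hn : ((n : ℝ) + 1) ≠ 0 := by positivity
  have hend : a + ((n + 1 : ℕ) : ℝ) * ((b - a) / (n + 1)) = b := by
    push_cast; field_simp; ring
  have h := hstep (n + 1) ((b - a) / (n + 1)) (div_nonneg (sub_nonneg.2 hab) (by positivity))
    hend.le
  rw [hend] at h
  refine h.trans_eq ?_
  have harg : C * ((b - a) / (n + 1)) / 2 = C * (b - a) * (1 / (n + 1)) / 2 := by ring
  simp [harg]

theorem inner_add_pos_of_angle_add_angle_lt_pi {E : Type*} [NormedAddCommGroup E]
    [InnerProductSpace ℝ E] {x y z : E} (hx : ‖x‖ = 1) (hy : ‖y‖ = 1) (hz : ‖z‖ = 1)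
    (h : InnerProductGeometry.angle x y + InnerProductGeometry.angle y z < π) :
    0 < inner ℝ (x + z) y := by
  have h1 := InnerProductGeometry.cos_angle x y
  have h2 := InnerProductGeometry.cos_angle y z
  rw [hx, hy, mul_one, div_one] at h1
  rw [hy, hz, mul_one, div_one] at h2
  have := cos_lt_cos_of_nonneg_of_le_pi (InnerProductGeometry.angle_nonneg x y)
    (sub_le_self π (InnerProductGeometry.angle_nonneg y z)) (lt_sub_iff_add_lt.2 h)
  rw [cos_pi_sub] at this
  rw [inner_add_left, real_inner_comm y z]
  linarith

theorem IsKConstrained.angle_le {κ s : ℝ} {σ σ' σ'' : ℝ → Plane}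
    (h : IsKConstrained κ s σ σ' σ'') {a b : ℝ} (ha : 0 ≤ a) (hab : a ≤ b) (hb : b ≤ s) :
    InnerProductGeometry.angle (σ' a) (σ' b) ≤ κ * (b - a) := by
  obtain ⟨-, -, hcont, hunit, F, hF⟩ := h
  have hsub : ∀ {x y : ℝ}, a ≤ x → y ≤ b → Icc x y ⊆ Icc 0 s := fun hx hy =>
    Icc_subset_Icc (ha.trans hx) (hy.trans hb)
  refine angle_le_of_norm_sub_le hab (fun t ht => hunit t (hsub le_rfl le_rfl ht)) ?_
  intro x hx y hy hxy
  exact norm_image_sub_le_of_hasDerivAt_off_finset F hxy (hcont.mono (hsub hx.1 hy.2))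
    fun t ht => hF t (hsub hx.1 hy.2 (Ioo_subset_Icc_self ht))

theorem IsKConstrained.two_pi_mul_le_of_closed {r s : ℝ} (hr : 0 < r) {σ σ' σ'' : ℝ → Plane}
    (h : IsKConstrained (1 / r) s σ σ' σ'') (hσ : σ 0 = σ s) (hσ' : σ' 0 = σ' s) (hs : 0 < s) :
    2 * π * r ≤ s := by
  by_contra! hlt
  have hhalf : 1 / r * (s / 2) < π := by
    rw [one_div_mul_eq_div, div_lt_iff₀ hr]
    linarith
  have hpos : ∀ t ∈ Ioo 0 s, 0 < inner ℝ (σ' 0 + σ' (s / 2)) (σ' t) := by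
    intro t ht
    have hunit := h.2.2.2.1
    refine inner_add_pos_of_angle_add_angle_lt_pi (hunit 0 ⟨le_rfl, hs.le⟩)
      (hunit t (Ioo_subset_Icc_self ht)) (hunit (s / 2) ⟨by linarith, by linarith⟩) ?_
    refine lt_of_le_of_lt ?_ hhalf
    rcases le_total t (s / 2) with hts | hts
    · have h1 := h.angle_le le_rfl ht.1.le ht.2.le
      have h2 := h.angle_le ht.1.le hts (by linarith)
      linear_combination h1 + h2
    · have h1 := h.angle_le ht.1.le ht.2.le le_rfl
      have h2 := h.angle_le (by linarith) hts ht.2.le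
      rw [hσ', InnerProductGeometry.angle_comm (σ' s), InnerProductGeometry.angle_comm (σ' t)
        (σ' (s / 2))]
      linear_combination h1 + h2
  have hd : ∀ t ∈ Icc 0 s, HasDerivAt (fun t => inner ℝ (σ' 0 + σ' (s / 2)) (σ t))
      (inner ℝ (σ' 0 + σ' (s / 2)) (σ' t)) t := fun t ht => by
    simpa using (hasDerivAt_const t (σ' 0 + σ' (s / 2))).inner ℝ (h.2.1 t ht)
  obtain ⟨t, ht, h0⟩ := exists_hasDerivAt_eq_zero hs
    (fun t ht => (hd t ht).continuousAt.continuousWithinAt) (by simp only [hσ])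
    (fun t ht => hd t (Ioo_subset_Icc_self ht))
  exact (hpos t ht).ne' h0

theorem hasDerivAt_plane {f g : ℝ → ℝ} {f' g' t : ℝ} (hf : HasDerivAt f f' t)
    (hg : HasDerivAt g g' t) :
    HasDerivAt (fun t => (!₂[f t, g t] : Plane)) !₂[f', g'] t := by
  have h : HasDerivAt (fun t => ![f t, g t]) ![f', g'] t := by
    rw [hasDerivAt_pi, Fin.forall_fin_two]
    exact ⟨hf, hg⟩
  exact (PiLp.continuousLinearEquiv 2 ℝ (fun _ : Fin 2 => ℝ)).symm.hasFDerivAt.comp_hasDerivAt t h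

theorem exists_isKConstrained_circle {r : ℝ} (hr : 0 < r) :
    ∃ (σ σ' σ'' : ℝ → Plane) (c : Plane),
      IsKConstrained (1 / r) (2 * π * r) σ σ' σ'' ∧
      σ 0 = σ (2 * π * r) ∧ σ' 0 = σ' (2 * π * r) ∧
      ∀ t ∈ Icc (0:ℝ) (2 * π * r), dist (σ t) c = r := by
  have hdiv : ∀ t, HasDerivAt (fun t : ℝ => t / r) (1 / r) t := fun t =>
    (hasDerivAt_id t).div_const r
  have hd : ∀ t, HasDerivAt (fun t => (!₂[r * cos (t / r), r * sin (t / r)] : Plane))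
      !₂[-sin (t / r), cos (t / r)] t := fun t => by
    refine hasDerivAt_plane ?_ ?_
    · exact ((hdiv t).cos.const_mul r).congr_deriv (by field_simp)
    · exact ((hdiv t).sin.const_mul r).congr_deriv (by field_simp)
  have hd' : ∀ t, HasDerivAt (fun t => (!₂[-sin (t / r), cos (t / r)] : Plane))
      !₂[-(cos (t / r) * (1 / r)), -sin (t / r) * (1 / r)] t := fun t =>
    hasDerivAt_plane (hdiv t).sin.neg (hdiv t).cos
  refine ⟨_, _, _, 0, ⟨by positivity, fun t _ => hd t,
    fun t _ => (hd' t).continuousAt.continuousWithinAt, fun t _ => ?_, ∅,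
    fun t _ _ => ⟨hd' t, ?_⟩⟩, ?_, ?_, fun t _ => ?_⟩
  · simp [EuclideanSpace.norm_eq]
  · refine le_of_eq ?_
    rw [EuclideanSpace.norm_eq, sqrt_eq_iff_mul_self_eq (by positivity) (by positivity)]
    simp [mul_pow, ← add_mul]
    ring
  · simp [hr.ne']
  · simp [hr.ne']
  · rw [dist_zero_right, EuclideanSpace.norm_eq,
      sqrt_eq_iff_mul_self_eq (by positivity) hr.le]
    simp [mul_pow, ← mul_add]
    ring

/-- Any closed curve with curvature bounded by 1/r has length at least 2πr, and
equality is achieved by a circle of radius r. -/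
theorem closed_curve_length (r : ℝ) (hr : 0 < r) :
    (∀ (s : ℝ) (σ σ' σ'' : ℝ → Plane),
        IsKConstrained (1 / r) s σ σ' σ'' →
        σ 0 = σ s → σ' 0 = σ' s → 0 < s →
        2 * π * r ≤ s) ∧
    (∃ (σ σ' σ'' : ℝ → Plane) (c : Plane),
        IsKConstrained (1 / r) (2 * π * r) σ σ' σ'' ∧
        σ 0 = σ (2 * π * r) ∧ σ' 0 = σ' (2 * π * r) ∧
        ∀ t ∈ Icc (0:ℝ) (2 * π * r), dist (σ t) c = r) := by
  exact ⟨fun _ _ _ _ h hσ hσ' hs => h.two_pi_mul_le_of_closed hr hσ hσ' hs,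
    exists_isKConstrained_circle hr⟩
end
end

section
/- Let x, y ∈ ℝ² with 0 < dist(x,y) < 2r, and let D₁, D₂ be the two radius-r disks with x, y on their boundary circles C₁, C₂. Let U = D₁ ∪ D₂ and I = int(D₁ ∩ D₂). If a κ-constrained curve (κ = 1/r) from x to y has its image contained in U, then either its image is contained in cl(I), or its image is contained in C₁, or its image is contained in C₂. -/
open Set Metric

noncomputable section

theorem le_of_hasDerivAt_nonneg_off_finset {φ φ' : ℝ → ℝ} (F : Finset ℝ) {a b : ℝ} (hab : a ≤ b)
    (hc : ContinuousOn φ (Icc a b))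
    (hd : ∀ t ∈ Ioo a b, t ∉ F → HasDerivAt φ (φ' t) t ∧ 0 ≤ φ' t) :
    φ a ≤ φ b := by
  induction F using Finset.strongInduction generalizing a b with
  | H F ih =>
    by_cases h : ∃ m ∈ F, m ∈ Ioo a b
    · obtain ⟨m, hmF, hm⟩ := h
      refine (ih (F.erase m) (Finset.erase_ssubset hmF) hm.1.le
        (hc.mono (Icc_subset_Icc_right hm.2.le)) ?_).trans
        (ih (F.erase m) (Finset.erase_ssubset hmF) hm.2.le
        (hc.mono (Icc_subset_Icc_left hm.1.le)) ?_)
      · intro t ht htF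
        exact hd t ⟨ht.1, ht.2.trans hm.2⟩ fun h => htF (Finset.mem_erase.2 ⟨ht.2.ne, h⟩)
      · intro t ht htF
        exact hd t ⟨hm.1.trans ht.1, ht.2⟩ fun h => htF (Finset.mem_erase.2 ⟨ht.1.ne', h⟩)
    · push Not at h
      have hd' : ∀ t ∈ Ioo a b, HasDerivAt φ (φ' t) t ∧ 0 ≤ φ' t :=
        fun t ht => hd t ht fun hF => h t hF ht
      refine monotoneOn_of_deriv_nonneg (convex_Icc a b) hc ?_ ?_
        (left_mem_Icc.2 hab) (right_mem_Icc.2 hab) hab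
      · rw [interior_Icc]
        exact fun t ht => (hd' t ht).1.differentiableAt.differentiableWithinAt
      · rw [interior_Icc]
        exact fun t ht => (hd' t ht).1.deriv ▸ (hd' t ht).2

theorem norm_sub_le_of_hasDerivAt_off_finset {E : Type*} [NormedAddCommGroup E]
    [InnerProductSpace ℝ E] {φ φ' : ℝ → E} {C : ℝ} (F : Finset ℝ) {a b : ℝ} (hab : a ≤ b)
    (hc : ContinuousOn φ (Icc a b))
    (hd : ∀ t ∈ Ioo a b, t ∉ F → HasDerivAt φ (φ' t) t ∧ ‖φ' t‖ ≤ C) :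
    ‖φ b - φ a‖ ≤ C * (b - a) := by
  set w := φ b - φ a with hw
  rcases (norm_nonneg w).eq_or_lt with h0 | h0
  · rw [← h0]
    by_cases h : ∃ t ∈ Ioo a b, t ∉ F
    · obtain ⟨t, ht, htF⟩ := h
      exact mul_nonneg ((norm_nonneg _).trans (hd t ht htF).2) (sub_nonneg.2 hab)
    · push Not at h
      have : b ≤ a := by
        by_contra! hlt
        exact (Ioo_infinite hlt) (F.finite_toSet.subset h)
      simp [le_antisymm hab this]
  have key := le_of_hasDerivAt_nonneg_off_finset (φ := fun t => C * ‖w‖ * t - inner ℝ (φ t) w)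
    (φ' := fun t => C * ‖w‖ * 1 - inner ℝ (φ' t) w) F hab
    (by fun_prop) ?_
  · have : inner ℝ (φ b) w - inner ℝ (φ a) w = ‖w‖ * ‖w‖ := by
      rw [← inner_sub_left, ← hw, real_inner_self_eq_norm_mul_norm]
    refine le_of_mul_le_mul_right ?_ h0
    nlinarith
  · intro t ht htF
    obtain ⟨h1, h2⟩ := hd t ht htF
    refine ⟨((hasDerivAt_id t).const_mul _).sub ?_, ?_⟩
    · simpa using h1.inner ℝ (hasDerivAt_const t w)
    · have := real_inner_le_norm (φ' t) w
      nlinarith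

/-- A unit-speed curve on `[a, b]` whose velocity has, off a finite set, derivative of norm at
most `1 / r`. -/
structure IsUnitSpeedBounded (r a b : ℝ) (σ σ' : ℝ → ℂ) : Prop where
  hasDerivAt : ∀ t ∈ Icc a b, HasDerivAt σ (σ' t) t
  continuousOn_deriv : ContinuousOn σ' (Icc a b)
  norm_deriv : ∀ t ∈ Icc a b, ‖σ' t‖ = 1
  exists_second_deriv : ∃ (F : Finset ℝ) (σ'' : ℝ → ℂ), ∀ t ∈ Icc a b, t ∉ F →
    HasDerivAt σ' (σ'' t) t ∧ ‖σ'' t‖ ≤ 1 / r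

namespace IsUnitSpeedBounded

variable {r a b : ℝ} {σ σ' : ℝ → ℂ}

theorem mono (h : IsUnitSpeedBounded r a b σ σ') {a' b' : ℝ} (ha : a ≤ a') (hb : b' ≤ b) :
    IsUnitSpeedBounded r a' b' σ σ' := by
  have hs : Icc a' b' ⊆ Icc a b := Icc_subset_Icc ha hb
  obtain ⟨F, σ'', hF⟩ := h.exists_second_deriv
  exact ⟨fun t ht => h.hasDerivAt t (hs ht), h.continuousOn_deriv.mono hs,
    fun t ht => h.norm_deriv t (hs ht), F, σ'', fun t ht => hF t (hs ht)⟩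

theorem reverse (h : IsUnitSpeedBounded r a b σ σ') :
    IsUnitSpeedBounded r (-b) (-a) (fun t => σ (-t)) (fun t => -σ' (-t)) := by
  have hs : ∀ t ∈ Icc (-b) (-a), -t ∈ Icc a b := fun t ht =>
    ⟨by linarith [ht.2], by linarith [ht.1]⟩
  obtain ⟨F, σ'', hF⟩ := h.exists_second_deriv
  refine ⟨fun t ht => ?_, ?_, fun t ht => ?_, F.image Neg.neg, fun t => σ'' (-t), fun t ht htF => ?_⟩
  · simpa [Function.comp_def] using (h.hasDerivAt _ (hs t ht)).scomp t (hasDerivAt_neg t)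
  · exact (h.continuousOn_deriv.comp continuousOn_neg hs).neg
  · simpa using h.norm_deriv _ (hs t ht)
  · have hn : -t ∉ F := fun hm => htF (Finset.mem_image.2 ⟨-t, hm, neg_neg t⟩)
    obtain ⟨h1, h2⟩ := hF _ (hs t ht) hn
    refine ⟨?_, h2⟩
    simpa [Function.comp_def, Pi.neg_def] using (h1.scomp t (hasDerivAt_neg t)).neg

theorem continuousOn (h : IsUnitSpeedBounded r a b σ σ') : ContinuousOn σ (Icc a b) :=
  fun t ht => (h.hasDerivAt t ht).continuousAt.continuousWithinAt

/-- The velocity turns by an angle of at most `t / r` in time `t`. -/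
theorem abs_arg_le (h : IsUnitSpeedBounded r a b σ σ') (hr : 0 < r) (hab : a ≤ b)
    (hT : b - a ≤ r * (Real.pi / 2)) :
    |(σ' b * (starRingEnd ℂ) (σ' a)).arg| ≤ (b - a) / r := by
  obtain ⟨F, σ'', hF⟩ := h.exists_second_deriv
  have ha : a ∈ Icc a b := left_mem_Icc.2 hab
  have hmul : σ' a * (starRingEnd ℂ) (σ' a) = 1 := by
    rw [Complex.mul_conj, Complex.normSq_eq_norm_sq, h.norm_deriv a ha]; simp
  set z : ℝ → ℂ := fun t => σ' t * (starRingEnd ℂ) (σ' a) with hz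
  have hz1 : ∀ t ∈ Icc a b, ‖z t‖ = 1 := fun t ht => by
    simp [hz, h.norm_deriv t ht, h.norm_deriv a ha]
  have hchord : ∀ t ∈ Icc a b, ‖z t - 1‖ < 2 := fun t ht => by
    have := norm_sub_le_of_hasDerivAt_off_finset (φ := σ') (φ' := σ'') (C := 1 / r) F ht.1
      (h.continuousOn_deriv.mono (Icc_subset_Icc_right ht.2))
      (fun u hu huF => hF u ⟨hu.1.le, hu.2.le.trans ht.2⟩ huF)
    have he : z t - 1 = (σ' t - σ' a) * (starRingEnd ℂ) (σ' a) := by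
      rw [sub_mul, hmul]
    rw [he, norm_mul, RCLike.norm_conj, h.norm_deriv a ha, mul_one]
    refine this.trans_lt ?_
    rw [one_div_mul_eq_div, div_lt_iff₀ hr]
    nlinarith [Real.pi_lt_four, ht.2]
  have hslit : ∀ t ∈ Icc a b, z t ∈ Complex.slitPlane := fun t ht => by
    rw [Complex.mem_slitPlane_iff]
    by_contra! hn
    have h1 : (z t).re * (z t).re + (z t).im * (z t).im = 1 := by
      rw [← Complex.normSq_apply, Complex.normSq_eq_norm_sq, hz1 t ht, one_pow]
    have h2 : z t = -1 := by
      apply Complex.ext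
      · simp; nlinarith
      · simp [hn.2]
    have := hchord t ht
    rw [h2] at this
    norm_num at this
  have hcz : ContinuousOn z (Icc a b) := h.continuousOn_deriv.mul continuousOn_const
  have key := norm_sub_le_of_hasDerivAt_off_finset (φ := fun t => Complex.log (z t))
    (φ' := fun t => σ'' t * (starRingEnd ℂ) (σ' a) / z t) (C := 1 / r) F hab
    (hcz.clog hslit) ?_
  · have hza : z a = 1 := hmul
    rw [hza, Complex.log_one, sub_zero, one_div_mul_eq_div] at key
    rw [← Complex.log_im]
    exact (Complex.abs_im_le_norm _).trans key
  · intro t ht htF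
    have ht' := Ioo_subset_Icc_self ht
    obtain ⟨h1, h2⟩ := hF t ht' htF
    refine ⟨(h1.mul_const _).clog_real (hslit t ht'), ?_⟩
    rw [norm_div, norm_mul, RCLike.norm_conj, hz1 t ht', h.norm_deriv a ha]
    simpa using h2

/-- The cartesian components of the velocity relative to its initial value. -/
theorem cos_le_re_and_abs_im_le_sin (h : IsUnitSpeedBounded r a b σ σ') (hr : 0 < r) (hab : a ≤ b)
    (hT : b - a ≤ r * (Real.pi / 2)) :
    Real.cos ((b - a) / r) ≤ (σ' b * (starRingEnd ℂ) (σ' a)).re ∧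
    |(σ' b * (starRingEnd ℂ) (σ' a)).im| ≤ Real.sin ((b - a) / r) := by
  have harg := h.abs_arg_le hr hab hT
  have hle : (b - a) / r ≤ Real.pi / 2 := by rwa [div_le_iff₀' hr]
  set z := σ' b * (starRingEnd ℂ) (σ' a) with hz
  have hz1 : ‖z‖ = 1 := by
    simp [hz, h.norm_deriv a (left_mem_Icc.2 hab), h.norm_deriv b (right_mem_Icc.2 hab)]
  rw [← Complex.norm_mul_cos_arg, ← Complex.norm_mul_sin_arg, hz1, one_mul, one_mul]
  constructor
  · rw [← Real.cos_abs z.arg]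
    exact Real.cos_le_cos_of_nonneg_of_le_pi (abs_nonneg _) (by linarith [Real.pi_pos]) harg
  · have h1 := abs_le.1 harg
    rw [abs_le, ← Real.sin_neg]
    constructor <;> apply Real.sin_le_sin_of_le_of_le_pi_div_two <;> linarith

/-- In the frame of its initial velocity, the curve advances at least as far as an arc of radius
`r` and deviates at most as much. -/
theorem advance_and_deviation (h : IsUnitSpeedBounded r a b σ σ') (hr : 0 < r) (hab : a ≤ b)
    (hT : b - a ≤ r * (Real.pi / 2)) :
    r * Real.sin ((b - a) / r) ≤ ((σ b - σ a) * (starRingEnd ℂ) (σ' a)).re ∧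
    |((σ b - σ a) * (starRingEnd ℂ) (σ' a)).im| ≤ r * (1 - Real.cos ((b - a) / r)) := by
  set Z : ℝ → ℂ := fun t => (σ t - σ a) * (starRingEnd ℂ) (σ' a) with hZ
  have hZd : ∀ t ∈ Icc a b, HasDerivAt Z (σ' t * (starRingEnd ℂ) (σ' a)) t := fun t ht =>
    ((h.hasDerivAt t ht).sub_const _).mul_const _
  have hre : ∀ t ∈ Icc a b,
      HasDerivAt (fun u => (Z u).re) (σ' t * (starRingEnd ℂ) (σ' a)).re t := fun t ht =>
    Complex.reCLM.hasFDerivAt.comp_hasDerivAt t (hZd t ht)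
  have him : ∀ t ∈ Icc a b,
      HasDerivAt (fun u => (Z u).im) (σ' t * (starRingEnd ℂ) (σ' a)).im t := fun t ht =>
    Complex.imCLM.hasFDerivAt.comp_hasDerivAt t (hZd t ht)
  have hin : ∀ t, HasDerivAt (fun u => (u - a) / r) (1 / r) t := fun t =>
    ((hasDerivAt_id t).sub_const a).div_const r
  have hsin : ∀ t, HasDerivAt (fun u => r * Real.sin ((u - a) / r))
      (Real.cos ((t - a) / r)) t := fun t => by
    refine (((hin t).sin).const_mul r).congr_deriv ?_
    field_simp
  have hcos : ∀ t, HasDerivAt (fun u => r * (1 - Real.cos ((u - a) / r)))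
      (Real.sin ((t - a) / r)) t := fun t => by
    refine (((hin t).cos.const_sub 1).const_mul r).congr_deriv ?_
    field_simp
  have hvel : ∀ t ∈ Icc a b, _ := fun t ht =>
    (h.mono le_rfl ht.2).cos_le_re_and_abs_im_le_sin hr ht.1 (by linarith [ht.2])
  have hZa : Z a = 0 := by simp [hZ]
  have mono : ∀ φ φ' : ℝ → ℝ, (∀ t ∈ Icc a b, HasDerivAt φ (φ' t) t) → (∀ t ∈ Icc a b, 0 ≤ φ' t) →
      φ a ≤ φ b := fun φ φ' h1 h2 =>
    le_of_hasDerivAt_nonneg_off_finset (φ' := φ') ∅ hab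
      (fun t ht => (h1 t ht).continuousAt.continuousWithinAt)
      (fun t ht _ => ⟨h1 t (Ioo_subset_Icc_self ht), h2 t (Ioo_subset_Icc_self ht)⟩)
  have k1 := mono _ _ (fun t ht => (hre t ht).sub (hsin t))
    (fun t ht => by linarith [(hvel t ht).1])
  have k2 := mono _ _ (fun t ht => (hcos t).sub (him t ht))
    (fun t ht => by linarith [(abs_le.1 (hvel t ht).2).2])
  have k3 := mono _ _ (fun t ht => (hcos t).add (him t ht))
    (fun t ht => by linarith [(abs_le.1 (hvel t ht).2).1])
  simp [hZa] at k1 k2 k3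
  refine ⟨k1, abs_le.2 ⟨by linarith, by linarith⟩⟩

/-- A curve starting outside a disk of radius `r`, perpendicularly to the radius, stays outside
for a quarter of a turn. -/
theorem lt_norm_sub (h : IsUnitSpeedBounded r a b σ σ') (hr : 0 < r) (hab : a ≤ b)
    (hT : b - a ≤ r * (Real.pi / 2)) {c : ℂ} (hc : r < ‖σ a - c‖)
    (hperp : inner ℝ (σ a - c) (σ' a) = 0) : r < ‖σ b - c‖ := by
  obtain ⟨h1, h2⟩ := h.advance_and_deviation hr hab hT
  have hn := h.norm_deriv a (left_mem_Icc.2 hab)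
  set w := (starRingEnd ℂ) (σ' a) with hw
  have hwn : ‖w‖ = 1 := by rw [hw, RCLike.norm_conj, hn]
  have hre : ((σ a - c) * w).re = 0 := by
    rw [← hperp, real_inner_comm, Complex.inner]
  have hle : (b - a) / r ≤ Real.pi / 2 := by rwa [div_le_iff₀' hr]
  have h0 : 0 ≤ (b - a) / r := div_nonneg (by linarith) hr.le
  have hcos := Real.cos_nonneg_of_mem_Icc (x := (b - a) / r) ⟨by linarith [Real.pi_pos], hle⟩
  have hsin := Real.sin_nonneg_of_nonneg_of_le_pi h0 (by linarith [Real.pi_pos])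
  have hsc := Real.sin_sq_add_cos_sq ((b - a) / r)
  have him : r < |((σ a - c) * w).im| := by
    have : ‖(σ a - c) * w‖ = ‖σ a - c‖ := by rw [norm_mul, hwn, mul_one]
    rw [← this] at hc
    refine hc.trans_eq ?_
    rw [← sq_eq_sq₀ (norm_nonneg _) (abs_nonneg _), ← Complex.normSq_eq_norm_sq,
      Complex.normSq_apply, hre, sq_abs]
    ring
  have hsum : (σ b - c) * w = (σ b - σ a) * w + (σ a - c) * w := by ring
  have hbn : ‖σ b - c‖ = ‖(σ b - c) * w‖ := by rw [norm_mul, hwn, mul_one]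
  rw [hbn, ← abs_of_pos hr, ← abs_norm, ← sq_lt_sq, ← Complex.normSq_eq_norm_sq,
    Complex.normSq_apply, hsum, Complex.add_re, Complex.add_im, hre, add_zero]
  set p := ((σ b - σ a) * w).re
  set q := ((σ b - σ a) * w).im
  set m := ((σ a - c) * w).im
  set S := Real.sin ((b - a) / r)
  set C := Real.cos ((b - a) / r)
  have hqm : r * C < |q + m| := by
    have := abs_sub_abs_le_abs_sub m (-q)
    rw [abs_neg, sub_neg_eq_add, add_comm] at this
    linarith
  have e1 : (r * S) ^ 2 ≤ p ^ 2 := pow_le_pow_left₀ (by positivity) h1 2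
  have e2 : (r * C) ^ 2 < (q + m) ^ 2 := by
    rw [← sq_abs (q + m)]
    exact pow_lt_pow_left₀ hqm (by positivity) two_ne_zero
  nlinarith

theorem hasDerivAt_norm_sub_sq (h : IsUnitSpeedBounded r a b σ σ') (c : ℂ) {t : ℝ}
    (ht : t ∈ Icc a b) :
    HasDerivAt (fun u => ‖σ u - c‖ ^ 2) (2 * inner ℝ (σ t - c) (σ' t)) t :=
  ((h.hasDerivAt t ht).sub_const c).norm_sq

theorem continuousOn_inner (h : IsUnitSpeedBounded r a b σ σ') (c : ℂ) :
    ContinuousOn (fun t => inner ℝ (σ t - c) (σ' t)) (Icc a b) :=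
  (h.continuousOn.sub continuousOn_const).inner h.continuousOn_deriv

theorem continuousOn_norm_sub (h : IsUnitSpeedBounded r a b σ σ') (c : ℂ) :
    ContinuousOn (fun t => ‖σ t - c‖) (Icc a b) :=
  (h.continuousOn.sub continuousOn_const).norm

theorem inner_eq_zero_of_isLocalMax (h : IsUnitSpeedBounded r a b σ σ') {c : ℂ} {t : ℝ}
    (ht : t ∈ Ioo a b) (hmax : ∀ᶠ u in nhds t, ‖σ u - c‖ ≤ ‖σ t - c‖) :
    inner ℝ (σ t - c) (σ' t) = 0 := by
  have : IsLocalMax (fun u => ‖σ u - c‖ ^ 2) t := by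
    filter_upwards [hmax] with u hu
    exact pow_le_pow_left₀ (norm_nonneg _) hu 2
  have := this.hasDerivAt_eq_zero (h.hasDerivAt_norm_sub_sq c (Ioo_subset_Icc_self ht))
  linarith

/-- While the curve stays in a disk of radius `r`, the squared distance to its center is convex. -/
theorem monotoneOn_inner (h : IsUnitSpeedBounded r a b σ σ') (hr : 0 < r) {c : ℂ}
    (hc : ∀ t ∈ Icc a b, ‖σ t - c‖ ≤ r) :
    MonotoneOn (fun t => inner ℝ (σ t - c) (σ' t)) (Icc a b) := by
  obtain ⟨F, σ'', hF⟩ := h.exists_second_deriv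
  intro p hp q hq hpq
  have hs : Icc p q ⊆ Icc a b := Icc_subset_Icc hp.1 hq.2
  refine le_of_hasDerivAt_nonneg_off_finset
    (φ' := fun t => inner ℝ (σ t - c) (σ'' t) + inner ℝ (σ' t) (σ' t)) F hpq
    ((h.continuousOn_inner c).mono hs) fun t ht htF => ?_
  have ht' := hs (Ioo_subset_Icc_self ht)
  obtain ⟨h1, h2⟩ := hF t ht' htF
  refine ⟨((h.hasDerivAt t ht').sub_const c).inner ℝ h1, ?_⟩
  rw [real_inner_self_eq_norm_sq, h.norm_deriv t ht']
  have h3 := neg_le_of_abs_le (abs_real_inner_le_norm (σ t - c) (σ'' t))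
  have h4 : ‖σ t - c‖ * ‖σ'' t‖ ≤ r * (1 / r) :=
    mul_le_mul (hc t ht') h2 (norm_nonneg _) hr.le
  rw [mul_one_div_cancel hr.ne'] at h4
  linarith

theorem norm_eq_and_inner_eq_zero_right (h : IsUnitSpeedBounded r a b σ σ') (hr : 0 < r) {c : ℂ}
    (hc : ∀ t ∈ Icc a b, ‖σ t - c‖ ≤ r) (ha : ‖σ a - c‖ = r)
    (hperp : inner ℝ (σ a - c) (σ' a) = 0) :
    ∀ t ∈ Icc a b, ‖σ t - c‖ = r ∧ inner ℝ (σ t - c) (σ' t) = 0 := by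
  have hm := h.monotoneOn_inner hr hc
  have hEq : ∀ t ∈ Icc a b, ‖σ t - c‖ = r := fun t ht => by
    have hs : Icc a t ⊆ Icc a b := Icc_subset_Icc_right ht.2
    have := le_of_hasDerivAt_nonneg_off_finset (φ := fun u => ‖σ u - c‖ ^ 2)
      (φ' := fun u => 2 * inner ℝ (σ u - c) (σ' u)) ∅ ht.1
      (((h.continuousOn_norm_sub c).mono hs).pow 2) fun u hu _ => by
        have hu' := hs (Ioo_subset_Icc_self hu)
        refine ⟨h.hasDerivAt_norm_sub_sq c hu', ?_⟩
        have := hm ⟨le_rfl, hu'.1.trans hu'.2⟩ hu' hu'.1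
        simp only [hperp] at this
        linarith
    rw [← ha]
    refine le_antisymm (ha ▸ hc t ht) ?_
    exact (pow_le_pow_iff_left₀ (norm_nonneg _) (norm_nonneg _) two_ne_zero).1 this
  intro t ht
  refine ⟨hEq t ht, ?_⟩
  rcases (ht.1.trans ht.2).eq_or_lt with hab | hab
  · rw [le_antisymm (ht.2.trans_eq hab.symm) ht.1, hperp]
  · have h1 := (h.hasDerivAt_norm_sub_sq c ht).hasDerivWithinAt (s := Icc a b)
    have h2 : HasDerivWithinAt (fun u => ‖σ u - c‖ ^ 2) 0 (Icc a b) t :=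
      (hasDerivWithinAt_const t (Icc a b) (r ^ 2)).congr (fun u hu => by rw [hEq u hu])
        (by rw [hEq t ht])
    have := (uniqueDiffOn_Icc hab t ht).eq_deriv _ h1 h2
    linarith

/-- A curve in a disk of radius `r` that is tangent to the boundary circle at some time runs along
that circle. -/
theorem norm_eq_and_inner_eq_zero (h : IsUnitSpeedBounded r a b σ σ') (hr : 0 < r) {c : ℂ}
    (hc : ∀ t ∈ Icc a b, ‖σ t - c‖ ≤ r) {m : ℝ} (hm : m ∈ Icc a b) (hmr : ‖σ m - c‖ = r)
    (hperp : inner ℝ (σ m - c) (σ' m) = 0) :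
    ∀ t ∈ Icc a b, ‖σ t - c‖ = r ∧ inner ℝ (σ t - c) (σ' t) = 0 := by
  intro t ht
  rcases le_total m t with hmt | hmt
  · exact (h.mono hm.1 le_rfl).norm_eq_and_inner_eq_zero_right hr
      (fun u hu => hc u ⟨hm.1.trans hu.1, hu.2⟩) hmr hperp t ⟨hmt, ht.2⟩
  · have := (h.mono le_rfl hm.2).reverse.norm_eq_and_inner_eq_zero_right hr (c := c)
      (fun u hu => hc (-u) ⟨by linarith [hu.2], by linarith [hu.1, hm.2]⟩) (by simpa using hmr)
      (by simpa [-Complex.inner] using hperp) (-t) ⟨by linarith, by linarith [ht.1]⟩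
    simpa [-Complex.inner] using this

/-- A curve that leaves the disk around `c₂` and comes back, staying in the disk around `c₁` in the
meantime, is tangent to the circle around `c₁` at some intermediate time. -/
theorem exists_tangent (h : IsUnitSpeedBounded r a b σ σ') (hr : 0 < r) {c₁ c₂ : ℂ}
    (ha : ‖σ a - c₂‖ ≤ r) (hb : ‖σ b - c₂‖ ≤ r) (hout : ∃ t ∈ Icc a b, r < ‖σ t - c₂‖)
    (hU : ∀ t ∈ Icc a b, r < ‖σ t - c₂‖ → ‖σ t - c₁‖ ≤ r) :
    ∃ t ∈ Icc a b, ‖σ t - c₁‖ = r ∧ inner ℝ (σ t - c₁) (σ' t) = 0 := by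
  obtain ⟨t₁, ht₁, hrt₁⟩ := hout
  obtain ⟨m, hm, hmax⟩ := isCompact_Icc.exists_isMaxOn ⟨t₁, ht₁⟩ (h.continuousOn_norm_sub c₂)
  have hrm : r < ‖σ m - c₂‖ := hrt₁.trans_le (hmax ht₁)
  have ham : a < m := hm.1.lt_of_ne fun e => hrm.not_ge (e ▸ ha)
  have hmb : m < b := hm.2.lt_of_ne fun e => hrm.not_ge (e ▸ hb)
  have hperp : inner ℝ (σ m - c₂) (σ' m) = 0 := by
    refine h.inner_eq_zero_of_isLocalMax ⟨ham, hmb⟩ ?_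
    filter_upwards [Icc_mem_nhds ham hmb] with u hu using hmax hu
  have hperp' : inner ℝ (σ (- -m) - c₂) (-σ' (- -m)) = 0 := by simpa [-Complex.inner] using hperp
  have hrm' : r < ‖σ (- -m) - c₂‖ := by simpa using hrm
  have hfwd := h.mono hm.1 le_rfl
  have hbwd := (h.mono le_rfl hm.2).reverse
  have hpi := Real.pi_pos
  set T := r * (Real.pi / 2) with hT
  have hTpos : 0 < T := by positivity
  have hTr : T / r = Real.pi / 2 := by rw [hT]; field_simp
  have hmT : m + T < b := by
    by_contra! hn
    exact (hfwd.lt_norm_sub hr hmb.le (by linarith) hrm hperp).not_ge hb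
  have hmT' : a < m - T := by
    by_contra! hn
    have := hbwd.lt_norm_sub hr (by linarith) (by linarith) hrm' hperp'
    rw [neg_neg] at this
    exact this.not_ge ha
  have hfwdT := h.mono hm.1 hmT.le
  have hbwdT := ((h.mono hmT'.le hm.2).reverse)
  have e1 := (hfwdT.advance_and_deviation hr (by linarith) (by linarith)).1
  have e2 := (hbwdT.advance_and_deviation hr (by linarith) (by linarith)).1
  have g1 := hfwdT.lt_norm_sub hr (by linarith) (by linarith) hrm hperp
  have g2 := hbwdT.lt_norm_sub hr (by linarith) (by linarith) hrm' hperp'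
  rw [show m + T - m = T by ring, hTr, Real.sin_pi_div_two, mul_one] at e1
  rw [show -(m - T) - -m = T by ring, hTr, Real.sin_pi_div_two, mul_one] at e2
  simp only [neg_neg] at e2 g2
  have hp : m + T ∈ Ioo a b := ⟨by linarith, hmT⟩
  have hq : m - T ∈ Ioo a b := ⟨hmT', by linarith⟩
  have f1 := hU _ (Ioo_subset_Icc_self hp) g1
  have f2 := hU _ (Ioo_subset_Icc_self hq) g2
  have hdist : 2 * r ≤ ‖σ (m + T) - σ (m - T)‖ := by
    have hn : ‖(σ (m + T) - σ (m - T)) * (starRingEnd ℂ) (σ' m)‖ = ‖σ (m + T) - σ (m - T)‖ := by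
      rw [norm_mul, RCLike.norm_conj, h.norm_deriv m hm, mul_one]
    rw [← hn]
    refine le_trans ?_ (Complex.re_le_norm _)
    have : (σ (m + T) - σ (m - T)) * (starRingEnd ℂ) (σ' m) =
        (σ (m + T) - σ m) * (starRingEnd ℂ) (σ' m) +
        (σ (m - T) - σ m) * (starRingEnd ℂ) (-σ' m) := by rw [map_neg]; ring
    rw [this, Complex.add_re]
    linarith
  have heq : ‖σ (m + T) - c₁‖ = r := by
    have := norm_sub_le (σ (m + T) - c₁) (σ (m - T) - c₁)
    rw [sub_sub_sub_cancel_right] at this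
    linarith
  refine ⟨m + T, Ioo_subset_Icc_self hp, heq, h.inner_eq_zero_of_isLocalMax hp ?_⟩
  have hnhds := Icc_mem_nhds hp.1 hp.2
  have hcont := (h.continuousOn_norm_sub c₂).continuousAt hnhds
  filter_upwards [hnhds, hcont.eventually (lt_mem_nhds g1)] with u hu hu'
  rw [heq]
  exact hU u hu hu'

/-- Outside of the disk around `c₂`, a curve in the union of two disks of radius `r` with
endpoints in the disk around `c₂` runs along the circle around `c₁`. -/
theorem norm_eq_and_inner_eq_zero_of_lt (h : IsUnitSpeedBounded r a b σ σ') (hr : 0 < r) {c₁ c₂ : ℂ}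
    (ha : ‖σ a - c₂‖ ≤ r) (hb : ‖σ b - c₂‖ ≤ r)
    (hU : ∀ t ∈ Icc a b, r < ‖σ t - c₂‖ → ‖σ t - c₁‖ ≤ r)
    {t : ℝ} (ht : t ∈ Icc a b) (hrt : r < ‖σ t - c₂‖) :
    ‖σ t - c₁‖ = r ∧ inner ℝ (σ t - c₁) (σ' t) = 0 := by
  have hg := h.continuousOn_norm_sub c₂
  obtain ⟨p, ⟨hp, hpr⟩, hpmax⟩ : ∃ p, IsGreatest (Icc a t ∩ (fun u => ‖σ u - c₂‖) ⁻¹' Iic r) p :=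
    (isCompact_Icc.of_isClosed_subset
      ((hg.mono (Icc_subset_Icc_right ht.2)).preimage_isClosed_of_isClosed isClosed_Icc isClosed_Iic)
      inter_subset_left).exists_isGreatest ⟨a, ⟨le_rfl, ht.1⟩, ha⟩
  obtain ⟨q, ⟨hq, hqr⟩, hqmin⟩ : ∃ q, IsLeast (Icc t b ∩ (fun u => ‖σ u - c₂‖) ⁻¹' Iic r) q :=
    (isCompact_Icc.of_isClosed_subset
      ((hg.mono (Icc_subset_Icc_left ht.1)).preimage_isClosed_of_isClosed isClosed_Icc isClosed_Iic)
      inter_subset_left).exists_isLeast ⟨b, ⟨ht.2, le_rfl⟩, hb⟩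
  have hpt : p < t := hp.2.lt_of_ne fun e => hrt.not_ge (e ▸ hpr)
  have htq : t < q := hq.1.lt_of_ne' fun e => hrt.not_ge (e ▸ hqr)
  have hpq := h.mono hp.1 hq.2
  have hsub : Icc p q ⊆ Icc a b := Icc_subset_Icc hp.1 hq.2
  have hopen : ∀ u ∈ Ioo p q, ‖σ u - c₁‖ ≤ r := fun u hu => by
    refine hU u (hsub (Ioo_subset_Icc_self hu)) ?_
    by_contra! hn
    rcases le_total u t with hut | hut
    · exact hu.1.not_ge (hpmax ⟨⟨hp.1.trans hu.1.le, hut⟩, hn⟩)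
    · exact hu.2.not_ge (hqmin ⟨⟨hut, hu.2.le.trans hq.2⟩, hn⟩)
  have hclosed : ∀ u ∈ Icc p q, ‖σ u - c₁‖ ≤ r := by
    have hcl : closure (Ioo p q) = Icc p q := closure_Ioo (hpt.trans htq).ne
    have := (hpq.continuousOn_norm_sub c₁)
    rw [← hcl] at this ⊢
    intro u hu
    exact le_on_closure hopen this continuousOn_const hu
  obtain ⟨m, hm, hm1, hm2⟩ := hpq.exists_tangent hr hpr hqr ⟨t, ⟨hpt.le, htq.le⟩, hrt⟩
    (fun u hu => hU u (hsub hu))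
  exact hpq.norm_eq_and_inner_eq_zero hr hclosed hm hm1 hm2 t ⟨hpt.le, htq.le⟩

/-- If a curve runs outside of the disk around `c₂` and later outside of the disk around `c₁`, then
it is tangent to both circles at a common time. -/
theorem exists_common_tangent (h : IsUnitSpeedBounded r a b σ σ') (hr : 0 < r) {c₁ c₂ : ℂ}
    (ha₁ : ‖σ a - c₁‖ ≤ r) (hb₁ : ‖σ b - c₁‖ ≤ r) (ha₂ : ‖σ a - c₂‖ ≤ r) (hb₂ : ‖σ b - c₂‖ ≤ r)
    (hU : ∀ t ∈ Icc a b, ‖σ t - c₁‖ ≤ r ∨ ‖σ t - c₂‖ ≤ r)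
    {p q : ℝ} (hp : p ∈ Icc a b) (hq : q ∈ Icc a b) (hpq : p ≤ q)
    (hp₂ : r < ‖σ p - c₂‖) (hq₁ : r < ‖σ q - c₁‖) :
    ∃ t ∈ Icc a b, (‖σ t - c₁‖ = r ∧ inner ℝ (σ t - c₁) (σ' t) = 0) ∧
      (‖σ t - c₂‖ = r ∧ inner ℝ (σ t - c₂) (σ' t) = 0) := by
  have hp₁ := h.norm_eq_and_inner_eq_zero_of_lt hr ha₂ hb₂
    (fun t ht hlt => (hU t ht).resolve_right hlt.not_ge) hp hp₂
  set A := {u | u ∈ Icc p q ∧ r < ‖σ u - c₁‖}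
  have hAne : A.Nonempty := ⟨q, ⟨hpq, le_rfl⟩, hq₁⟩
  have hAbdd : BddBelow A := ⟨p, fun u hu => hu.1.1⟩
  have hsub : Icc p q ⊆ Icc a b := Icc_subset_Icc hp.1 hq.2
  have hAab : A ⊆ Icc a b := fun u hu => hsub hu.1
  set τ := sInf A
  have hτp : p ≤ τ := le_csInf hAne fun u hu => hu.1.1
  have hτq : τ ≤ q := csInf_le hAbdd ⟨⟨hpq, le_rfl⟩, hq₁⟩
  have hτab : τ ∈ Icc a b := hsub ⟨hτp, hτq⟩
  have hτA : τ ∈ closure A := csInf_mem_closure hAne hAbdd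
  have hB : ∀ u ∈ A, ‖σ u - c₂‖ = r ∧ inner ℝ (σ u - c₂) (σ' u) = 0 := fun u hu =>
    h.norm_eq_and_inner_eq_zero_of_lt hr ha₁ hb₁
      (fun t ht hlt => (hU t ht).resolve_left hlt.not_ge) (hAab hu) hu.2
  have hlim : ∀ {φ : ℝ → ℝ} {v : ℝ}, ContinuousOn φ (Icc a b) → (∀ u ∈ A, φ u = v) → φ τ = v :=
    fun hφ hv => by
      have hcl : closure A ⊆ Icc a b := closure_minimal hAab isClosed_Icc
      exact EqOn.of_subset_closure (g := fun _ => _) hv (hφ.mono hcl) continuousOn_const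
        subset_closure le_rfl hτA
  refine ⟨τ, hτab, ?_, hlim (h.continuousOn_norm_sub c₂) fun u hu => (hB u hu).1,
    hlim (h.continuousOn_inner c₂) fun u hu => (hB u hu).2⟩
  have hlt : ∀ u ∈ Ico p τ, ‖σ u - c₁‖ ≤ r := fun u hu => by
    by_contra! hn
    exact hu.2.not_ge (csInf_le hAbdd ⟨⟨hu.1, hu.2.le.trans hτq⟩, hn⟩)
  have hle : ∀ u ∈ Icc p τ, ‖σ u - c₁‖ ≤ r := by
    rcases hτp.eq_or_lt with e | e
    · intro u hu
      rw [le_antisymm (hu.2.trans_eq e.symm) hu.1, hp₁.1]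
    · have hcl : closure (Ico p τ) = Icc p τ := closure_Ico e.ne
      have := (h.mono hp.1 hτab.2).continuousOn_norm_sub c₁
      rw [← hcl] at this ⊢
      exact fun u hu => le_on_closure hlt this continuousOn_const hu
  exact (h.mono hp.1 hτab.2).norm_eq_and_inner_eq_zero hr hle ⟨le_rfl, hτp⟩ hp₁.1 hp₁.2 τ
    ⟨hτp, le_rfl⟩

end IsUnitSpeedBounded

/-- Two distinct circles of radius `r` with a common tangent line at a common point do not have two
distinct common points. -/
theorem eq_of_common_tangent {r : ℝ} {c₁ c₂ p v x y : ℂ} (hcc : c₁ ≠ c₂) (hv : ‖v‖ = 1)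
    (hp₁ : ‖p - c₁‖ = r) (hv₁ : inner ℝ (p - c₁) v = 0)
    (hp₂ : ‖p - c₂‖ = r) (hv₂ : inner ℝ (p - c₂) v = 0)
    (hx₁ : ‖x - c₁‖ = r) (hx₂ : ‖x - c₂‖ = r) (hy₁ : ‖y - c₁‖ = r) (hy₂ : ‖y - c₂‖ = r) :
    x = y := by
  have hw : ∀ c, ‖p - c‖ = r → inner ℝ (p - c) v = 0 →
      ∃ α : ℝ, p - c = α * (Complex.I * v) ∧ α ^ 2 = r ^ 2 := fun c h1 h2 => by
    have hvv : v * (starRingEnd ℂ) v = 1 := by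
      rw [Complex.mul_conj, Complex.normSq_eq_norm_sq, hv]; simp
    rw [real_inner_comm, Complex.inner] at h2
    have he' : p - c = (((p - c) * (starRingEnd ℂ) v).im : ℝ) * (Complex.I * v) := by
      have he := Complex.re_add_im ((p - c) * (starRingEnd ℂ) v)
      rw [h2, Complex.ofReal_zero, zero_add] at he
      rw [← mul_assoc, he, mul_assoc, mul_comm _ v, hvv, mul_one]
    refine ⟨_, he', ?_⟩
    have hn := congrArg norm he'
    rw [norm_mul, norm_mul, Complex.norm_I, hv, Complex.norm_real, Real.norm_eq_abs, h1] at hn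
    rw [hn, mul_one, mul_one, sq_abs]
  obtain ⟨α, ha, har⟩ := hw c₁ hp₁ hv₁
  obtain ⟨β, hb, hbr⟩ := hw c₂ hp₂ hv₂
  have hαβ : α = -β := by
    rcases sq_eq_sq_iff_eq_or_eq_neg.1 (har.trans hbr.symm) with e | e
    · exact absurd (sub_right_injective (ha.trans (e ▸ hb.symm))) hcc
    · exact e
  have hsum : p - c₁ = -(p - c₂) := by rw [ha, hb, hαβ]; push_cast; ring
  have hmid : ∀ z, ‖z - c₁‖ = r → ‖z - c₂‖ = r → z = p := fun z h1 h2 => by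
    have e1 : z - c₁ = (z - p) + (p - c₁) := by ring
    have e2 : z - c₂ = (z - p) - (p - c₁) := by rw [hsum]; ring
    have := parallelogram_law_with_norm ℝ (z - p) (p - c₁)
    rw [← e1, ← e2, h1, h2, hp₁] at this
    have : ‖z - p‖ ^ 2 = 0 := by linarith
    exact sub_eq_zero.1 (norm_eq_zero.1 (pow_eq_zero_iff two_ne_zero |>.1 this))
  rw [hmid x hx₁ hx₂, hmid y hy₁ hy₂]

theorem closure_interior_inter_closedBall {r : ℝ} {c₁ c₂ x y : Plane} (hxy : x ≠ y)
    (hx₁ : dist x c₁ = r) (hx₂ : dist x c₂ = r) (hy₁ : dist y c₁ = r) (hy₂ : dist y c₂ = r) :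
    closure (interior (closedBall c₁ r ∩ closedBall c₂ r)) = closedBall c₁ r ∩ closedBall c₂ r := by
  have hmid : ∀ c : Plane, dist x c = r → dist y c = r →
      (2⁻¹ : ℝ) • x + (2⁻¹ : ℝ) • y ∈ interior (closedBall c r) := fun c h1 h2 =>
    strictConvex_closedBall ℝ c r h1.le h2.le hxy (by norm_num) (by norm_num) (by norm_num)
  have hconv := (convex_closedBall c₁ r).inter (convex_closedBall c₂ r)
  rw [hconv.closure_interior_eq_closure_of_nonempty_interior,
    (isClosed_closedBall.inter isClosed_closedBall).closure_eq]
  rw [interior_inter]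
  exact ⟨_, ⟨hmid c₁ hx₁ hy₁, hmid c₂ hx₂ hy₂⟩⟩

/-- For 0 < dist(x,y) < 2r, a (1/r)-constrained curve from x to y contained in
U = D₁ ∪ D₂ is contained in cl(I), or in the circle C₁, or in the circle C₂. -/
theorem curve_in_union_trichotomy (r s : ℝ) (hr : 0 < r)
    (x y c₁ c₂ : Plane)
    (hd : 0 < dist x y) (hd2 : dist x y < 2 * r)
    (hc₁x : dist c₁ x = r) (hc₁y : dist c₁ y = r)
    (hc₂x : dist c₂ x = r) (hc₂y : dist c₂ y = r)
    (hcc : c₁ ≠ c₂)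
    (σ σ' σ'' : ℝ → Plane)
    (hσ : IsKConstrained (1 / r) s σ σ' σ'')
    (hx : σ 0 = x) (hy : σ s = y)
    (hU : ∀ t ∈ Icc (0:ℝ) s, σ t ∈ closedBall c₁ r ∪ closedBall c₂ r) :
    (∀ t ∈ Icc (0:ℝ) s,
        σ t ∈ closure (interior (closedBall c₁ r ∩ closedBall c₂ r))) ∨
    (∀ t ∈ Icc (0:ℝ) s, σ t ∈ sphere c₁ r) ∨
    (∀ t ∈ Icc (0:ℝ) s, σ t ∈ sphere c₂ r) := by
  obtain ⟨hs, hder, hcont, hunit, F, hF⟩ := hσ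
  set e : Plane ≃ₗᵢ[ℝ] ℂ := Complex.orthonormalBasisOneI.repr.symm
  have hed : ∀ {f : ℝ → Plane} {f' : Plane} {t : ℝ}, HasDerivAt f f' t →
      HasDerivAt (fun u => e (f u)) (e f') t := fun hf =>
    (e.toContinuousLinearEquiv : Plane →L[ℝ] ℂ).hasFDerivAt.comp_hasDerivAt _ hf
  have hen : ∀ p q : Plane, ‖e p - e q‖ = dist p q := fun p q => by
    rw [← dist_eq_norm, e.dist_map]
  have h : IsUnitSpeedBounded r 0 s (fun t => e (σ t)) (fun t => e (σ' t)) :=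
    ⟨fun t ht => hed (hder t ht), e.continuous.comp_continuousOn hcont,
      fun t ht => by rw [e.norm_map, hunit t ht], F, fun t => e (σ'' t),
      fun t ht htF => ⟨hed (hF t ht htF).1, by rw [e.norm_map]; exact (hF t ht htF).2⟩⟩
  rw [dist_comm] at hc₁x hc₁y hc₂x hc₂y
  have hxy : x ≠ y := dist_pos.1 hd
  have ha₁ : ‖e (σ 0) - e c₁‖ = r := by rw [hen, hx, hc₁x]
  have ha₂ : ‖e (σ 0) - e c₂‖ = r := by rw [hen, hx, hc₂x]
  have hb₁ : ‖e (σ s) - e c₁‖ = r := by rw [hen, hy, hc₁y]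
  have hb₂ : ‖e (σ s) - e c₂‖ = r := by rw [hen, hy, hc₂y]
  have hU' : ∀ t ∈ Icc (0 : ℝ) s, ‖e (σ t) - e c₁‖ ≤ r ∨ ‖e (σ t) - e c₂‖ ≤ r := fun t ht => by
    rw [hen, hen]; exact hU t ht
  have hsphere : ∀ {c c' : Plane}, ‖e (σ 0) - e c'‖ = r → ‖e (σ s) - e c'‖ = r →
      (∀ t ∈ Icc (0 : ℝ) s, ‖e (σ t) - e c‖ ≤ r) → (∃ t ∈ Icc (0 : ℝ) s, r < ‖e (σ t) - e c'‖) →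
      ∀ t ∈ Icc (0 : ℝ) s, σ t ∈ sphere c r := fun ha hb hin hout t ht => by
    obtain ⟨m, hm, hmr, hperp⟩ := h.exists_tangent hr ha.le hb.le hout fun u hu _ => hin u hu
    have := (h.norm_eq_and_inner_eq_zero hr hin hm hmr hperp t ht).1
    rwa [hen] at this
  by_cases h₁ : ∀ t ∈ Icc (0 : ℝ) s, ‖e (σ t) - e c₁‖ ≤ r
  · by_cases h₂ : ∀ t ∈ Icc (0 : ℝ) s, ‖e (σ t) - e c₂‖ ≤ r
    · left
      intro t ht
      rw [closure_interior_inter_closedBall hxy hc₁x hc₂x hc₁y hc₂y]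
      have k₁ := h₁ t ht
      have k₂ := h₂ t ht
      rw [hen] at k₁ k₂
      exact ⟨k₁, k₂⟩
    · push Not at h₂
      exact Or.inr (Or.inl (hsphere ha₂ hb₂ h₁ h₂))
  · push Not at h₁
    by_cases h₂ : ∀ t ∈ Icc (0 : ℝ) s, ‖e (σ t) - e c₂‖ ≤ r
    · exact Or.inr (Or.inr (hsphere ha₁ hb₁ h₂ h₁))
    · push Not at h₂
      exfalso
      obtain ⟨q, hq, hq₁⟩ := h₁
      obtain ⟨p, hp, hp₂⟩ := h₂
      obtain ⟨t, ht, ⟨m₁, n₁⟩, m₂, n₂⟩ : ∃ t ∈ Icc 0 s,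
          (‖e (σ t) - e c₁‖ = r ∧ inner ℝ (e (σ t) - e c₁) (e (σ' t)) = 0) ∧
          (‖e (σ t) - e c₂‖ = r ∧ inner ℝ (e (σ t) - e c₂) (e (σ' t)) = 0) := by
        rcases le_total p q with hpq | hqp
        · exact h.exists_common_tangent hr ha₁.le hb₁.le ha₂.le hb₂.le hU' hp hq hpq hp₂ hq₁
        · obtain ⟨t, ht, k₂, k₁⟩ := h.exists_common_tangent hr ha₂.le hb₂.le ha₁.le hb₁.le
            (fun t ht => (hU' t ht).symm) hq hp hqp hq₁ hp₂
          exact ⟨t, ht, k₁, k₂⟩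
      have := eq_of_common_tangent (e.injective.ne hcc) (h.norm_deriv t ht) m₁ n₁ m₂ n₂
        ha₁ ha₂ hb₁ hb₂
      exact hxy (hx ▸ hy ▸ e.injective this)
end
end
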